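/- Masked random feed-forward networks are universal approximators with high probability: Let d, l ≥ 1 be natural numbers, let U ⊆ ℝ^d be compact, let h : ℝ^d → ℝ^l be continuous, and let ε > 0, δ ∈ (0,1), and R > 0. Then there exists a hidden-layer width m ∈ ℕ such that, if all entries of A ∈ ℝ^{l×m}, B ∈ ℝ^{m×d}, and b ∈ ℝ^m are mutually independent random variables each uniformly distributed on [−R, R], then with probability at least 1 − δ there exists a mask M ∈ {0,1}^m with ∫_U ‖h(x) − A·(M ⊙ ReLU(Bx + b))‖ dx ≤ ε, where the integral is with respect to Lebesgue measure on ℝ^d. -/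

import Mathlib

open MeasureTheory

/-- The ReLU activation function. -/
noncomputable def relu (t : ℝ) : ℝ := max t 0

/-- The uniform probability measure on the interval `[-R, R]`. -/
noncomputable def unif (R : ℝ) : Measure ℝ :=
  (volume (Set.Icc (-R) R))⁻¹ • volume.restrict (Set.Icc (-R) R)

/-- Index type for the parameters of a width-`m` one-hidden-layer network with input
dimension `d` and output dimension `l`: output entries, input entries, biases. -/
abbrev FFIdx (m d l : ℕ) := (Fin l × Fin m) ⊕ (Fin m × Fin d) ⊕ Fin m


open ProbabilityTheory

lemma unif_prob {R : ℝ} (hR : 0 < R) : IsProbabilityMeasure (unif R) := by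
  constructor
  have : (ENNReal.ofReal (R + R)) ≠ 0 := by simp; linarith
  simp only [unif, Measure.smul_apply, Measure.restrict_apply MeasurableSet.univ, Set.univ_inter,
    smul_eq_mul, Real.volume_Icc, sub_neg_eq_add]
  exact ENNReal.inv_mul_cancel this ENNReal.ofReal_ne_top

lemma unif_ball_pos {R c r : ℝ} (hR : 0 < R) (hc : |c| ≤ R) (hr : 0 < r) :
    0 < unif R (Metric.ball c r) := by
  have h1 := abs_le.1 hc
  simp only [unif, Measure.smul_apply, Measure.restrict_apply measurableSet_ball, smul_eq_mul]
  apply ENNReal.mul_pos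
  · simp
  · have hsub : Set.Ioo (max (c - r) (-R)) (min (c + r) R) ⊆ Metric.ball c r ∩ Set.Icc (-R) R := by
      intro x hx
      obtain ⟨h2, h3⟩ := hx
      rw [max_lt_iff] at h2
      rw [lt_min_iff] at h3
      refine ⟨?_, by constructor <;> linarith⟩
      rw [Real.ball_eq_Ioo]
      exact ⟨h2.1, h3.1⟩
    refine (lt_of_lt_of_le ?_ (measure_mono hsub)).ne'
    rw [Real.volume_Ioo, ENNReal.ofReal_pos, sub_pos, max_lt_iff, lt_min_iff, lt_min_iff]
    refine ⟨⟨?_, ?_⟩, ?_, ?_⟩ <;> linarith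

lemma box_meas {ι K C : Type} [Fintype ι] [Fintype K] [Fintype C]
    (e : ι × K ≃ C) (ν : Measure ℝ) [IsProbabilityMeasure ν] (S : ι → K → Set ℝ)
    (s : Finset ι) :
    Measure.pi (fun _ : C => ν) (⋂ i ∈ s, {ω | ∀ κ, ω (e (i, κ)) ∈ S i κ})
      = ∏ i ∈ s, ∏ κ, ν (S i κ) := by
  classical
  have h1 : (⋂ i ∈ s, {ω : C → ℝ | ∀ κ, ω (e (i, κ)) ∈ S i κ}) =
      Set.pi Set.univ (fun c => if (e.symm c).1 ∈ s then S (e.symm c).1 (e.symm c).2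
        else Set.univ) := by
    ext ω
    simp only [Set.mem_iInter, Set.mem_ofPred_eq, Set.mem_pi, Set.mem_univ, true_imp_iff]
    constructor
    · intro h c
      split_ifs with hc
      · simpa using h _ hc (e.symm c).2
      · trivial
    · intro h i hi κ
      simpa [hi] using h (e (i, κ))
  rw [h1, Measure.pi_pi, ← e.prod_comp, Fintype.prod_prod_type, ← Finset.prod_subset
    (Finset.subset_univ s)]
  · refine Finset.prod_congr rfl fun i hi => Finset.prod_congr rfl fun κ _ => ?_
    simp [hi]
  · intro i _ hi
    simp [hi]

lemma box_compl {ι K C : Type} [Fintype ι] [Fintype K] [Fintype C]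
    (e : ι × K ≃ C) (ν : Measure ℝ) [IsProbabilityMeasure ν] (S : ι → K → Set ℝ)
    (hS : ∀ i κ, MeasurableSet (S i κ)) (s : Finset ι) :
    Measure.pi (fun _ : C => ν) (⋂ i ∈ s, {ω | ∀ κ, ω (e (i, κ)) ∈ S i κ}ᶜ)
      = ∏ i ∈ s, (1 - ∏ κ, ν (S i κ)) := by
  have hm : ∀ i, MeasurableSet {ω : C → ℝ | ∀ κ, ω (e (i, κ)) ∈ S i κ} := by
    intro i
    rw [Set.ofPred_forall]
    exact MeasurableSet.iInter fun κ => measurable_pi_apply _ (hS i κ)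
  have h1 : ∀ i, Measure.pi (fun _ : C => ν) {ω | ∀ κ, ω (e (i, κ)) ∈ S i κ} =
      ∏ κ, ν (S i κ) := by
    intro i
    simpa using box_meas e ν S {i}
  have hI : iIndepSet (fun i => {ω : C → ℝ | ∀ κ, ω (e (i, κ)) ∈ S i κ})
      (Measure.pi (fun _ : C => ν)) := by
    rw [iIndepSet_iff_meas_biInter hm]
    intro s
    rw [box_meas]
    exact Finset.prod_congr rfl fun i _ => (h1 i).symm
  have h2 : iIndep _ _ := hI
  rw [h2.meas_biInter (S := s) (s := fun i => {ω : C → ℝ | ∀ κ, ω (e (i, κ)) ∈ S i κ}ᶜ)]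
  · refine Finset.prod_congr rfl fun i _ => ?_
    rw [prob_compl_eq_one_sub (hm i), h1]
  · intro i _
    exact (MeasurableSpace.measurableSet_generateFrom (Set.mem_singleton _)).compl

/-- equivalence -/
def idxE (m d l : ℕ) : Fin m × (Fin l ⊕ Fin d ⊕ Unit) ≃ FFIdx m d l where
  toFun z := match z with
    | (i, Sum.inl p) => Sum.inl (p, i)
    | (i, Sum.inr (Sum.inl q)) => Sum.inr (Sum.inl (i, q))
    | (i, Sum.inr (Sum.inr _)) => Sum.inr (Sum.inr i)
  invFun c := match c with
    | Sum.inl (p, i) => (i, Sum.inl p)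
    | Sum.inr (Sum.inl (i, q)) => (i, Sum.inr (Sum.inl q))
    | Sum.inr (Sum.inr i) => (i, Sum.inr (Sum.inr ()))
  left_inv := by rintro ⟨i, p | q | _⟩ <;> rfl
  right_inv := by rintro (⟨p, i⟩ | ⟨i, q⟩ | i) <;> rfl

lemma exists_width (d l n : ℕ) (θ : Fin n → (Fin l ⊕ Fin d ⊕ Unit) → ℝ) {R δ r : ℝ} (hR : 0 < R)
    (hθ : ∀ j κ, |θ j κ| ≤ R) (hδ : 0 < δ) (hr : 0 < r) :
    ∃ k : ℕ, ENNReal.ofReal (1 - δ) ≤ Measure.pi (fun _ : FFIdx (n * k) d l => unif R)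
      {ω | ∀ j : Fin n, ∃ t : Fin k, ∀ κ,
        ω (idxE (n * k) d l (finProdFinEquiv (j, t), κ)) ∈ Metric.ball (θ j κ) r} := by
  have := unif_prob hR
  let p : Fin n → ENNReal := fun j => ∏ κ, unif R (Metric.ball (θ j κ) r)
  have hp : ∀ j, 1 - p j < 1 := by
    intro j
    refine ENNReal.sub_lt_self ENNReal.one_ne_top one_ne_zero ?_
    exact Finset.prod_ne_zero_iff.2 fun κ _ => (unif_ball_pos hR (hθ j κ) hr).ne'
  have hlim : Filter.Tendsto (fun k : ℕ => ∑ j, (1 - p j) ^ k) Filter.atTop (nhds 0) := by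
    have : Filter.Tendsto (fun k : ℕ => ∑ j, (1 - p j) ^ k) Filter.atTop
        (nhds (∑ j : Fin n, 0)) :=
      tendsto_finsetSum _ fun j _ => ENNReal.tendsto_pow_atTop_nhds_zero_of_lt_one (hp j)
    simpa using this
  obtain ⟨k, hk⟩ := (hlim.eventually (gt_mem_nhds (ENNReal.ofReal_pos.2 hδ))).exists
  refine ⟨k, ?_⟩
  set μ := Measure.pi (fun _ : FFIdx (n * k) d l => unif R)
  set G := {ω : FFIdx (n * k) d l → ℝ | ∀ j : Fin n, ∃ t : Fin k, ∀ κ,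
        ω (idxE (n * k) d l (finProdFinEquiv (j, t), κ)) ∈ Metric.ball (θ j κ) r} with hG
  have hGm : MeasurableSet G := by
    simp only [hG, Set.ofPred_forall, Set.ofPred_exists]
    exact MeasurableSet.iInter fun j => MeasurableSet.iUnion fun t => MeasurableSet.iInter
      fun κ => measurable_pi_apply _ measurableSet_ball
  have hc : μ Gᶜ ≤ ENNReal.ofReal δ := by
    refine le_trans ?_ hk.le
    have hsub : Gᶜ ⊆ ⋃ j ∈ (Finset.univ : Finset (Fin n)),
        ⋂ i ∈ Finset.univ.image (fun t : Fin k => finProdFinEquiv (j, t)),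
        {ω | ∀ κ, ω (idxE (n * k) d l (i, κ)) ∈
          Metric.ball (θ (finProdFinEquiv.symm i).1 κ) r}ᶜ := by
      intro ω hω
      simp only [hG, Set.mem_compl_iff, Set.mem_ofPred_eq, not_forall, not_exists] at hω
      obtain ⟨j, hj⟩ := hω
      simp only [Set.mem_iUnion]
      refine ⟨j, Finset.mem_univ _, ?_⟩
      simp only [Set.mem_iInter, Finset.mem_image, Finset.mem_univ, true_and]
      rintro i ⟨t, rfl⟩
      simp only [Set.mem_compl_iff, Set.mem_ofPred_eq, not_forall, Equiv.symm_apply_apply]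
      exact hj t
    refine (measure_mono hsub).trans ((measure_biUnion_finset_le _ _).trans ?_)
    refine Finset.sum_le_sum fun j _ => ?_
    rw [box_compl (idxE (n * k) d l) (unif R)
      (fun i κ => Metric.ball (θ (finProdFinEquiv.symm i).1 κ) r)
      (fun _ _ => measurableSet_ball), Finset.prod_image]
    · simp [p]
    · intro a _ b _ hab
      simpa using hab
  have := prob_compl_eq_one_sub (μ := μ) hGm.compl
  rw [compl_compl] at this
  rw [this, ENNReal.ofReal_sub _ hδ.le, ENNReal.ofReal_one]
  exact tsub_le_tsub_left hc _

lemma relu_cont : Continuous relu := continuous_id.max continuous_const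

lemma relu_of_nonneg {t : ℝ} (h : 0 ≤ t) : relu t = t := max_eq_left h
lemma relu_of_nonpos {t : ℝ} (h : t ≤ 0) : relu t = 0 := max_eq_right h
lemma relu_mul {c : ℝ} (hc : 0 ≤ c) (t : ℝ) : relu (c * t) = c * relu t := by
  simp [relu, mul_max_of_nonneg _ _ hc]

/-- piecewise linear interpolation -/
noncomputable def pl (G : ℝ → ℝ) (n : ℕ) (t : ℝ) : ℝ :=
  G 0 + ∑ k ∈ Finset.range n, (G (k + 1) - G k) * (relu (t - k) - relu (t - k - 1))

lemma pl_right (G : ℝ → ℝ) (n : ℕ) (t : ℝ) (ht : n ≤ t) : pl G n t = G n := by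
  induction n with
  | zero => simp [pl]
  | succ n ih =>
    push_cast at ht
    have := ih (by linarith)
    rw [pl, Finset.sum_range_succ, ← add_assoc, ← pl, this, relu_of_nonneg (by linarith),
      relu_of_nonneg (by linarith)]
    push_cast
    ring

lemma pl_approx (G : ℝ → ℝ) (w : ℝ) (n : ℕ)
    (hG : ∀ s t : ℝ, 0 ≤ s → s ≤ n → 0 ≤ t → t ≤ n → |s - t| ≤ 1 → |G s - G t| ≤ w)
    (t : ℝ) (h0 : 0 ≤ t) (hn : t ≤ n) : |pl G n t - G t| ≤ w := by
  induction n with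
  | zero =>
    have : t = 0 := le_antisymm (by simpa using hn) h0
    have h2 := hG 0 0 (by simp) (by simp) (by simp) (by simp) (by simp)
    subst this
    simpa [pl] using h2
  | succ n ih =>
    push_cast at hn hG
    have hn0 : (0 : ℝ) ≤ n := n.cast_nonneg
    rcases le_total t n with h | h
    · have h1 := ih (fun s t a b c e f => hG s t a (by linarith) c (by linarith) f) h
      rw [pl, Finset.sum_range_succ, ← add_assoc, ← pl, relu_of_nonpos (by linarith),
        relu_of_nonpos (by linarith)]
      simpa using h1
    · rw [pl, Finset.sum_range_succ, ← add_assoc, ← pl, pl_right _ _ _ h,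
        relu_of_nonneg (by linarith), relu_of_nonpos (by linarith)]
      have h1 := hG n t hn0 (by linarith) h0 hn (by rw [abs_le]; constructor <;> linarith)
      have h2 := hG (n + 1) t (by linarith) (by linarith) h0 hn
        (by rw [abs_le]; constructor <;> linarith)
      rw [abs_le] at *
      constructor <;> nlinarith

/-- one neuron -/
noncomputable def nrn {d l : ℕ} (v : (Fin l ⊕ Fin d ⊕ Unit) → ℝ) (x : Fin d → ℝ) (p : Fin l) : ℝ :=
  v (Sum.inl p) * relu (∑ q, v (Sum.inr (Sum.inl q)) * x q + v (Sum.inr (Sum.inr ())))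

/-- networks with bounded weights -/
def NetB (d l : ℕ) (R : ℝ) (f : (Fin d → ℝ) → Fin l → ℝ) : Prop :=
  ∃ (n : ℕ) (θ : Fin n → (Fin l ⊕ Fin d ⊕ Unit) → ℝ), (∀ j κ, |θ j κ| ≤ R) ∧
    ∀ x p, f x p = ∑ j, nrn (θ j) x p

lemma NetB.zero (d l : ℕ) (R : ℝ) : NetB d l R 0 := ⟨0, fun _ _ => 0, by simp, by simp⟩

lemma NetB.add {d l : ℕ} {R : ℝ} {f g : (Fin d → ℝ) → Fin l → ℝ} (hf : NetB d l R f)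
    (hg : NetB d l R g) : NetB d l R (f + g) := by
  obtain ⟨n, θ, h1, h2⟩ := hf
  obtain ⟨n', θ', h1', h2'⟩ := hg
  refine ⟨n + n', Fin.append θ θ', ?_, ?_⟩
  · intro j
    refine Fin.addCases (fun i => ?_) (fun i => ?_) j
    · simpa using h1 i
    · simpa using h1' i
  · intro x p
    simp [Fin.sum_univ_add, h2, h2']

lemma NetB.nsmul {d l : ℕ} {R : ℝ} {f : (Fin d → ℝ) → Fin l → ℝ} (hf : NetB d l R f) (N : ℕ) :
    NetB d l R (N • f) := by
  induction N with
  | zero => simpa using NetB.zero d l R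
  | succ n ih => rw [succ_nsmul]; exact ih.add hf

lemma NetB.smul_small {d l : ℕ} {R : ℝ} {f : (Fin d → ℝ) → Fin l → ℝ} (hf : NetB d l R f)
    (c : ℝ) (hc : |c| ≤ 1) : NetB d l R (c • f) := by
  obtain ⟨n, θ, h1, h2⟩ := hf
  refine ⟨n, fun j => Sum.elim (fun p => c * θ j (Sum.inl p)) (fun κ => θ j (Sum.inr κ)), ?_, ?_⟩
  · rintro j (p | κ)
    · simp only [Sum.elim_inl, abs_mul]
      have := h1 j (Sum.inl p)
      nlinarith [abs_nonneg (θ j (Sum.inl p)), abs_nonneg c]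
    · simpa using h1 j _
  · intro x p
    simp [h2, nrn, Finset.mul_sum, mul_assoc]

lemma NetB.smul {d l : ℕ} {R : ℝ} {f : (Fin d → ℝ) → Fin l → ℝ} (hf : NetB d l R f)
    (c : ℝ) : NetB d l R (c • f) := by
  obtain ⟨N, hN⟩ := exists_nat_gt |c|
  have hN0 : (0 : ℝ) < N := (abs_nonneg c).trans_lt hN
  have := (hf.smul_small (c / N) (by
    rw [abs_div, abs_of_pos hN0, div_le_one hN0]; exact hN.le)).nsmul N
  convert this using 1
  rw [← Nat.cast_smul_eq_nsmul ℝ, smul_smul, mul_div_cancel₀ _ hN0.ne']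

lemma NetB.sum {d l : ℕ} {R : ℝ} {ι : Type} (s : Finset ι) (f : ι → (Fin d → ℝ) → Fin l → ℝ)
    (hf : ∀ i ∈ s, NetB d l R (f i)) : NetB d l R (∑ i ∈ s, f i) :=
  Finset.sum_induction _ _ (fun _ _ => NetB.add) (NetB.zero d l R) hf

lemma NetB.ridge {d l : ℕ} {R : ℝ} (hR : 0 < R) (w : Fin d → ℝ) (b : ℝ) (p : Fin l) :
    NetB d l R (fun x => Pi.single p (relu (∑ q, w q * x q + b))) := by
  obtain ⟨N, hN⟩ := exists_nat_gt ((∑ q, |w q| + |b|) / R)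
  have hS : 0 ≤ ∑ q, |w q| := Finset.sum_nonneg fun q _ => abs_nonneg _
  have hN0 : (0 : ℝ) < N := lt_of_le_of_lt (by positivity) hN
  rw [div_lt_iff₀ hR] at hN
  have h1 : NetB d l R (fun x => Pi.single p (R * relu (∑ q, (w q / N) * x q + b / N))) := by
    refine ⟨1, fun _ => Sum.elim (Pi.single p R) (Sum.elim (fun q => w q / N) (fun _ => b / N)),
      ?_, ?_⟩
    · rintro _ (p' | q | _)
      · simp only [Sum.elim_inl, Pi.single_apply]
        split_ifs
        · rw [abs_of_pos hR]
        · simpa using hR.le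
      · simp only [Sum.elim_inl, Sum.elim_inr, abs_div, Nat.abs_cast]
        rw [div_le_iff₀ hN0]
        have := Finset.single_le_sum (f := fun q => |w q|) (fun q _ => abs_nonneg _)
          (Finset.mem_univ q)
        nlinarith [abs_nonneg b]
      · simp only [Sum.elim_inr, abs_div, Nat.abs_cast]
        rw [div_le_iff₀ hN0]
        nlinarith
    · intro x p'
      simp only [Finset.univ_unique, Finset.sum_singleton, nrn, Sum.elim_inl, Sum.elim_inr,
        Pi.single_apply]
      split_ifs <;> simp
  convert h1.smul (N / R) using 1
  ext x p'
  simp only [Pi.smul_apply, Pi.single_apply, smul_eq_mul]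
  split_ifs
  · have : ∑ q, w q * x q + b = N * (∑ q, (w q / N) * x q + b / N) := by
      rw [mul_add, Finset.mul_sum]
      congr 1
      · exact Finset.sum_congr rfl fun q _ => by field_simp
      · field_simp
    rw [this, relu_mul hN0.le]
    field_simp
  · simp

/-- scalar approximability in output slot `p` -/
def Appr {d l : ℕ} (R : ℝ) (p : Fin l) (U : Set (Fin d → ℝ)) (f : U → ℝ) : Prop :=
  ∀ η > 0, ∃ g : (Fin d → ℝ) → ℝ, NetB d l R (fun x => Pi.single p (g x)) ∧
    ∀ x : U, |f x - g x| ≤ η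

lemma Appr.zero {d l : ℕ} (R : ℝ) (p : Fin l) (U : Set (Fin d → ℝ)) :
    Appr R p U (fun _ => 0) := by
  intro η hη
  refine ⟨fun _ => 0, ?_, fun x => by simpa using hη.le⟩
  convert NetB.zero d l R using 1
  ext x p'
  simp

lemma Appr.add {d l : ℕ} {R : ℝ} {p : Fin l} {U : Set (Fin d → ℝ)} {f f' : U → ℝ}
    (hf : Appr R p U f) (hf' : Appr R p U f') : Appr R p U (fun x => f x + f' x) := by
  intro η hη
  obtain ⟨g, h1, h2⟩ := hf (η / 2) (by linarith)
  obtain ⟨g', h1', h2'⟩ := hf' (η / 2) (by linarith)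
  refine ⟨fun x => g x + g' x, ?_, fun x => ?_⟩
  · convert h1.add h1' using 1
    ext x p'
    simp [Pi.single_add]
  · have a := abs_le.1 (h2 x)
    have b := abs_le.1 (h2' x)
    rw [abs_le]
    constructor <;> linarith

lemma Appr.smul {d l : ℕ} {R : ℝ} {p : Fin l} {U : Set (Fin d → ℝ)} {f : U → ℝ}
    (hf : Appr R p U f) (c : ℝ) : Appr R p U (fun x => c * f x) := by
  intro η hη
  have hc : 0 < |c| + 1 := by positivity
  obtain ⟨g, h1, h2⟩ := hf (η / (|c| + 1)) (by positivity)
  refine ⟨fun x => c * g x, ?_, fun x => ?_⟩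
  · convert h1.smul c using 1
    ext x p'
    simp only [Pi.smul_apply, Pi.single_apply, smul_eq_mul]
    split_ifs <;> simp
  · rw [← mul_sub, abs_mul]
    have h3 := h2 x
    rw [le_div_iff₀ hc] at h3
    nlinarith [abs_nonneg (f x - g x)]

lemma Appr.lim {d l : ℕ} {R : ℝ} {p : Fin l} {U : Set (Fin d → ℝ)} {f : U → ℝ}
    (hf : ∀ η > 0, ∃ f', Appr R p U f' ∧ ∀ x, |f x - f' x| ≤ η) : Appr R p U f := by
  intro η hη
  obtain ⟨f', h0, h⟩ := hf (η / 2) (by linarith)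
  obtain ⟨g, h1, h2⟩ := h0 (η / 2) (by linarith)
  refine ⟨g, h1, fun x => ?_⟩
  have a := abs_le.1 (h x)
  have b := abs_le.1 (h2 x)
  rw [abs_le]
  constructor <;> linarith

lemma Appr.ridge {d l : ℕ} {R : ℝ} (hR : 0 < R) (p : Fin l) (U : Set (Fin d → ℝ))
    (w : Fin d → ℝ) (b : ℝ) : Appr R p U (fun x => relu (∑ q, w q * x.1 q + b)) := by
  intro η hη
  exact ⟨fun x => relu (∑ q, w q * x q + b), NetB.ridge hR w b p, fun x => by simpa using hη.le⟩

lemma Appr.sum {d l : ℕ} {R : ℝ} {p : Fin l} {U : Set (Fin d → ℝ)} {ι : Type} (s : Finset ι)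
    (f : ι → U → ℝ) (hf : ∀ i, Appr R p U (f i)) : Appr R p U (fun x => ∑ i ∈ s, f i x) := by
  classical
  induction s using Finset.induction_on with
  | empty => simpa using Appr.zero R p U
  | insert a s ha ih =>
    simp only [Finset.sum_insert ha]
    exact (hf a).add ih

lemma Appr.exp {d l : ℕ} {R : ℝ} (hR : 0 < R) (p : Fin l) (U : Set (Fin d → ℝ))
    (hU : IsCompact U) (w : Fin d → ℝ) : Appr R p U (fun x => Real.exp (∑ q, w q * x.1 q)) := by
  apply Appr.lim
  intro η hη
  obtain ⟨T, hT0, hT⟩ : ∃ T : ℝ, 0 < T ∧ ∀ x ∈ U, |∑ q, w q * x q| ≤ T := by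
    obtain ⟨T, hT⟩ := hU.exists_bound_of_continuousOn (f := fun x => ∑ q, w q * x q)
      (by fun_prop)
    exact ⟨max T 1, by positivity, fun x hx => (hT x hx).trans (le_max_left _ _)⟩
  have huc := (isCompact_Icc (a := -T) (b := T)).uniformContinuousOn_of_continuous
    Real.continuous_exp.continuousOn
  obtain ⟨ρ, hρ, hρ'⟩ := Metric.uniformContinuousOn_iff.1 huc η hη
  obtain ⟨n, hn⟩ := exists_nat_gt (2 * T / ρ)
  have hn0 : (0 : ℝ) < n := lt_of_le_of_lt (by positivity) hn
  rw [div_lt_iff₀ hρ] at hn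
  set G : ℝ → ℝ := fun s => Real.exp (s * (2 * T / n) - T) with hG
  have key := pl_approx G η n (by
    intro s t hs hsn ht htn hst
    have hc : 0 < 2 * T / n := by positivity
    have hcn : n * (2 * T / n) = 2 * T := by field_simp
    refine (hρ' _ ?_ _ ?_ ?_).le
    · constructor
      · nlinarith
      · nlinarith
    · constructor
      · nlinarith
      · nlinarith
    · rw [Real.dist_eq]
      have : s * (2 * T / n) - T - (t * (2 * T / n) - T) = (s - t) * (2 * T / n) := by ring
      rw [this, abs_mul, abs_of_pos hc]
      have : 2 * T / n < ρ := by rw [div_lt_iff₀ hn0]; linarith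
      nlinarith)
  refine ⟨fun x => pl G n ((∑ q, w q * x.1 q + T) * (n / (2 * T))), ?_, ?_⟩
  · have hr : ∀ c : ℝ, Appr R p U
        (fun x => relu ((∑ q, w q * x.1 q + T) * (n / (2 * T)) - c)) := by
      intro c
      convert Appr.ridge hR p U (fun q => w q * (n / (2 * T))) (T * (n / (2 * T)) - c) using 3
      rw [add_mul, Finset.sum_mul, add_sub_assoc]
      congr 1
      exact Finset.sum_congr rfl fun q _ => by ring
    have h1 : Appr R p U (fun _ => 1) := by
      convert Appr.ridge hR p U (fun q => 0) 1 using 2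
      simp [relu]
    unfold pl
    refine Appr.add (by simpa using h1.smul (G 0)) (Appr.sum _ _ fun k => Appr.smul ?_ _)
    have := (hr k).add ((hr (k + 1)).smul (-1))
    convert this using 2
    rw [sub_add_eq_sub_sub]
    ring
  · intro x
    have hx := abs_le.1 (hT x.1 x.2)
    have h2 : 0 < (n : ℝ) / (2 * T) := by positivity
    have h3 : 2 * T * ((n : ℝ) / (2 * T)) = n := by field_simp
    have := key ((∑ q, w q * x.1 q + T) * (n / (2 * T)))
      (mul_nonneg (by linarith) h2.le) (by nlinarith)
    rw [abs_sub_comm]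
    convert this using 3
    simp only [hG]
    congr 1
    field_simp
    ring

lemma Appr.all {d l : ℕ} {R : ℝ} (hR : 0 < R) (p : Fin l) (U : Set (Fin d → ℝ))
    (hU : IsCompact U) (f : C(U, ℝ)) : Appr R p U f := by
  have : CompactSpace U := isCompact_iff_compactSpace.1 hU
  let E : Multiplicative (Fin d → ℝ) →* C(U, ℝ) :=
    { toFun := fun w => ⟨fun x => Real.exp (∑ q, (Multiplicative.toAdd w) q * x.1 q),
        Real.continuous_exp.comp (continuous_finsetSum _ fun q _ =>
          continuous_const.mul ((continuous_apply q).comp continuous_subtype_val))⟩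
      map_one' := by ext x; simp
      map_mul' := by
        intro w w'
        ext x
        simp [add_mul, Finset.sum_add_distrib, Real.exp_add] }
  let A : Subalgebra ℝ C(U, ℝ) := Algebra.adjoin ℝ (Set.range E)
  have hA : A.topologicalClosure = ⊤ := by
    apply ContinuousMap.subalgebra_topologicalClosure_eq_top_of_separatesPoints
    intro x y hxy
    have : ∃ q, x.1 q ≠ y.1 q := by
      by_contra hcon
      push Not at hcon
      exact hxy (Subtype.ext (funext hcon))
    obtain ⟨q, hq⟩ := this
    refine ⟨_, ⟨E (Multiplicative.ofAdd (Pi.single q 1)),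
      Algebra.subset_adjoin ⟨_, rfl⟩, rfl⟩, ?_⟩
    simpa [E, Pi.single_apply] using hq
  have hspan : ∀ g ∈ A, Appr R p U g := by
    intro g hg
    have hg' : g ∈ Submodule.span ℝ (Set.range E) := by
      have h1 : g ∈ Subalgebra.toSubmodule (Algebra.adjoin ℝ (Set.range E)) := hg
      rw [Algebra.adjoin_eq_span, ← MonoidHom.coe_mrange, Submonoid.closure_eq] at h1
      exact h1
    clear hg
    induction hg' using Submodule.span_induction with
    | mem x hx =>
      obtain ⟨w, rfl⟩ := hx
      exact Appr.exp hR p U hU (Multiplicative.toAdd w)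
    | zero => exact Appr.zero R p U
    | add x y _ _ hx hy => exact hx.add hy
    | smul a x _ hx => exact hx.smul a
  apply Appr.lim
  intro η hη
  have hf : f ∈ closure (A : Set C(U, ℝ)) := by
    rw [← Subalgebra.topologicalClosure_coe, hA]; trivial
  obtain ⟨g, hg, hd⟩ := Metric.mem_closure_iff.1 hf η hη
  refine ⟨g, hspan g hg, fun x => ?_⟩
  rw [← Real.dist_eq]
  exact (ContinuousMap.dist_apply_le_dist x).trans hd.le

lemma exists_net (d l : ℕ) {R : ℝ} (hR : 0 < R) (U : Set (Fin d → ℝ)) (hU : IsCompact U)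
    (h : (Fin d → ℝ) → Fin l → ℝ) (hh : Continuous h) {η : ℝ} (hη : 0 < η) :
    ∃ (n : ℕ) (θ : Fin n → (Fin l ⊕ Fin d ⊕ Unit) → ℝ), (∀ j κ, |θ j κ| ≤ R) ∧
      ∀ x ∈ U, ∀ p, |h x p - ∑ j, nrn (θ j) x p| < η := by
  have h1 : ∀ p : Fin l, ∃ g : (Fin d → ℝ) → ℝ, NetB d l R (fun x => Pi.single p (g x)) ∧
      ∀ x : U, |h x p - g x| ≤ η / 2 := fun p =>
    Appr.all hR p U hU ⟨fun x => h x p, by fun_prop⟩ (η / 2) (by linarith)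
  choose g hg hg' using h1
  obtain ⟨n, θ, h2, h3⟩ := NetB.sum Finset.univ _ (fun p _ => hg p)
  refine ⟨n, θ, h2, fun x hx p => ?_⟩
  rw [← h3]
  have : (∑ p, fun x => (Pi.single p (g p x) : Fin l → ℝ)) x p = g p x := by
    simp [Finset.sum_apply, Pi.single_apply]
  rw [this]
  exact lt_of_le_of_lt (hg' p ⟨x, hx⟩) (by linarith)

lemma net_stable {d l n : ℕ} (U : Set (Fin d → ℝ)) (hU : IsCompact U)
    (h : (Fin d → ℝ) → Fin l → ℝ) (hh : Continuous h) {η : ℝ}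
    (θ : Fin n → (Fin l ⊕ Fin d ⊕ Unit) → ℝ)
    (hap : ∀ x ∈ U, ∀ p, |h x p - ∑ j, nrn (θ j) x p| < η) :
    ∃ r > 0, ∀ θ' : Fin n → (Fin l ⊕ Fin d ⊕ Unit) → ℝ,
      (∀ j κ, θ' j κ ∈ Metric.ball (θ j κ) r) →
      ∀ x ∈ U, ∀ p, |h x p - ∑ j, nrn (θ' j) x p| < η := by
  have hev : ∀ᶠ θ' in nhds θ, ∀ x ∈ U, ∀ p, |h x p - ∑ j, nrn (θ' j) x p| < η := by
    apply hU.eventually_forall_of_forall_eventually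
    intro x hx
    rw [Filter.eventually_all]
    intro p
    have hc : Continuous (fun z : (Fin n → (Fin l ⊕ Fin d ⊕ Unit) → ℝ) × (Fin d → ℝ) =>
        |h z.2 p - ∑ j, nrn (z.1 j) z.2 p|) := by
      unfold nrn
      have := relu_cont
      fun_prop
    exact hc.continuousAt.eventually (gt_mem_nhds (hap x hx p))
  obtain ⟨r, hr, hr'⟩ := Metric.eventually_nhds_iff.1 hev
  refine ⟨r, hr, fun θ' hθ' => hr' ?_⟩
  rw [dist_pi_lt_iff hr]
  intro j
  rw [dist_pi_lt_iff hr]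
  exact fun κ => hθ' j κ

/-- Masked random feed-forward networks are universal approximators with high probability:
for any continuous target `h` on a compact `U`, any `ε > 0`, `δ ∈ (0,1)`, and `R > 0`,
there is a hidden width `m` such that, with all weights and biases mutually independent
and uniform on `[-R, R]`, with probability at least `1 - δ` there is a mask
`M ∈ {0,1}^m` making the masked random network `ε`-close to `h` in `L¹(U)`. -/
theorem masked_random_ffn_universal
    (d l : ℕ) (hd : 1 ≤ d) (hl : 1 ≤ l)
    (U : Set (Fin d → ℝ)) (hU : IsCompact U)
    (h : (Fin d → ℝ) → Fin l → ℝ) (hh : Continuous h)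
    (ε δ R : ℝ) (hε : 0 < ε) (hδ : δ ∈ Set.Ioo (0 : ℝ) 1) (hR : 0 < R) :
    ∃ m : ℕ,
      ENNReal.ofReal (1 - δ) ≤
        Measure.pi (fun _ : FFIdx m d l => unif R)
          {ω | ∃ M : Fin m → ℝ, (∀ i, M i = 0 ∨ M i = 1) ∧
            (∫ x in U, ∑ p, |h x p -
              ∑ i, ω (Sum.inl (p, i)) *
                (M i * relu (∑ q, ω (Sum.inr (Sum.inl (i, q))) * x q
                              + ω (Sum.inr (Sum.inr i))))|) ≤ ε} := by
  obtain ⟨hδ0, hδ1⟩ := hδ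
  set V : ℝ := (volume : Measure (Fin d → ℝ)).real U with hV
  have hV0 : 0 ≤ V := measureReal_nonneg
  let η : ℝ := ε / (l * V + 1)
  have hη : 0 < η := by positivity
  have hηV : l * η * V ≤ ε := by
    have : η * (l * V + 1) = ε := by simp only [η]; field_simp
    nlinarith
  obtain ⟨n, θ, hθ, hap⟩ := exists_net d l hR U hU h hh hη
  obtain ⟨r, hr, hr'⟩ := net_stable U hU h hh θ hap
  obtain ⟨k, hk⟩ := exists_width d l n θ hR hθ hδ0 hr
  refine ⟨n * k, hk.trans (measure_mono ?_)⟩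
  intro ω hω
  choose t ht using hω
  classical
  refine ⟨fun i => if i = finProdFinEquiv ((finProdFinEquiv.symm i).1,
    t (finProdFinEquiv.symm i).1) then 1 else 0, fun i => ?_, ?_⟩
  · dsimp only
    split_ifs <;> simp
  have hsum : ∀ x p, ∑ i, ω (Sum.inl (p, i)) * ((if i = finProdFinEquiv
      ((finProdFinEquiv.symm i).1, t (finProdFinEquiv.symm i).1) then 1 else 0) *
        relu (∑ q, ω (Sum.inr (Sum.inl (i, q))) * x q + ω (Sum.inr (Sum.inr i)))) =
      ∑ j, nrn (fun κ => ω (idxE (n * k) d l (finProdFinEquiv (j, t j), κ))) x p := by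
    intro x p
    rw [← finProdFinEquiv.sum_comp, Fintype.sum_prod_type]
    refine Finset.sum_congr rfl fun j _ => ?_
    rw [Finset.sum_eq_single (t j)]
    · simp [nrn, idxE]
    · intro b _ hb
      simp [hb]
    · simp
  simp only [hsum]
  have hb := hr' (fun j κ => ω (idxE (n * k) d l (finProdFinEquiv (j, t j), κ)))
    (fun j κ => ht j κ)
  refine (le_abs_self _).trans (le_trans ?_ hηV)
  rw [← Real.norm_eq_abs]
  refine norm_setIntegral_le_of_norm_le_const hU.measure_lt_top fun x hx => ?_
  rw [Real.norm_eq_abs, abs_of_nonneg (Finset.sum_nonneg fun _ _ => abs_nonneg _)]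
  refine (Finset.sum_le_sum fun p _ => (hb x hx p).le).trans ?_
  simp
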